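/- arXiv:2104.00434 — 2 statements merged into one kernel-verified Lean document; each statement's English description precedes it below -/
import Mathlib

section
/- Let G be a finite group with property (P) such that O₃(G) = 1 and G contains an element of order 4. Then Ω₁(G) is a proper subgroup of O₂(G). -/
/-- A finite group `G` has property (P) if it has even order and for all `x y : G`
with `x` of order 2, the subgroup generated by `x` and `y` is isomorphic to one of
`ℤ/2`, `ℤ/2 × ℤ/2`, `ℤ/4`, `ℤ/6`, `ℤ/2 × ℤ/4`, `ℤ/2 × ℤ/6` or `A₄`. -/
def PropertyP (G : Type*) [Group G] : Prop :=
  Even (Nat.card G) ∧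
  ∀ x y : G, orderOf x = 2 →
    Nonempty (↥(Subgroup.closure {x, y}) ≃* Multiplicative (ZMod 2)) ∨
    Nonempty (↥(Subgroup.closure {x, y}) ≃*
      Multiplicative (ZMod 2) × Multiplicative (ZMod 2)) ∨
    Nonempty (↥(Subgroup.closure {x, y}) ≃* Multiplicative (ZMod 4)) ∨
    Nonempty (↥(Subgroup.closure {x, y}) ≃* Multiplicative (ZMod 6)) ∨
    Nonempty (↥(Subgroup.closure {x, y}) ≃*
      Multiplicative (ZMod 2) × Multiplicative (ZMod 4)) ∨
    Nonempty (↥(Subgroup.closure {x, y}) ≃*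
      Multiplicative (ZMod 2) × Multiplicative (ZMod 6)) ∨
    Nonempty (↥(Subgroup.closure {x, y}) ≃* alternatingGroup (Fin 4))

/-- `Ω₁(H)`: the subgroup generated by all elements of order 2. -/
def omegaOne (G : Type*) [Group G] : Subgroup G :=
  Subgroup.closure {x : G | orderOf x = 2}

/-- `O_p(G)`: the largest normal `p`-subgroup of `G` (the join of all normal
`p`-subgroups). -/
def pCore (p : ℕ) (G : Type*) [Group G] : Subgroup G :=
  ⨆ P : {P : Subgroup G // P.Normal ∧ IsPGroup p ↥P}, (P : Subgroup G)

instance pCore_normal (p : ℕ) (G : Type*) [Group G] : (pCore p G).Normal := by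
  constructor
  intro x hx g
  refine Subgroup.iSup_induction _ (C := fun y => g * y * g⁻¹ ∈ pCore p G) hx
    (fun P y hy => ?_) (by simpa using Subgroup.one_mem _) (fun y z hy hz => ?_)
  · exact Subgroup.mem_iSup_of_mem P (P.2.1.conj_mem y hy g)
  · have h : g * (y * z) * g⁻¹ = (g * y * g⁻¹) * (g * z * g⁻¹) := by group
    show g * (y * z) * g⁻¹ ∈ pCore p G
    rw [h]; exact Subgroup.mul_mem _ hy hz

/-- Coxeter-type relation of `S₄`. -/
lemma aux_cox {Q : Type*} [Group Q] (a b c : Q) (ha : a * a = 1) (hb : b * b = 1)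
    (hc : c * c = 1) (hab : a * b = b * a) (h1 : (a * c) ^ 3 = 1) (h2 : (b * c) ^ 3 = 1)
    (h3 : (a * b * c) ^ 3 = 1) : a * b * c = 1 := by
  have ia : a⁻¹ = a := inv_eq_of_mul_eq_one_right ha
  have ib : b⁻¹ = b := inv_eq_of_mul_eq_one_right hb
  have ic : c⁻¹ = c := inv_eq_of_mul_eq_one_right hc
  have braid : ∀ x : Q, x⁻¹ = x → (x * c) ^ 3 = 1 → x * c * x = c * x * c := by
    intro x ix h
    have : (x * c * x) * (c * x * c) = 1 := by rw [← h]; simp only [pow_succ, pow_zero, one_mul, mul_assoc]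
    rw [eq_inv_of_mul_eq_one_left this]
    simp only [mul_inv_rev, ix, ic, mul_assoc]
  have e1 := braid a ia h1
  have e2 := braid b ib h2
  have key : a * b * c * (a * b * c) = c * a * b * c * a * b := by
    calc a * b * c * (a * b * c) = a * b * c * (b * a * c) := by rw [hab]
      _ = a * (b * c * b) * a * c := by simp only [mul_assoc]
      _ = a * c * b * (c * a * c) := by rw [e2]; simp only [mul_assoc]
      _ = (a * c) * (b * a) * c * a := by rw [← e1]; simp only [mul_assoc]
      _ = (a * c * a) * b * c * a := by rw [← hab]; simp only [mul_assoc]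
      _ = c * a * (c * b * c) * a := by rw [e1]; simp only [mul_assoc]
      _ = c * a * b * c * (b * a) := by rw [← e2]; simp only [mul_assoc]
      _ = c * a * b * c * a * b := by rw [← hab]; simp only [mul_assoc]
  have k2 : (a * b * c) ^ 4 = 1 := by
    have : (a * b * c) ^ 4 = (a * b * c * (a * b * c)) * (a * b * c * (a * b * c)) := by
      simp only [pow_succ, pow_zero, one_mul, mul_assoc]
    rw [this]
    nth_rewrite 1 [key]
    have : c * a * b * c * a * b = (a * b * c * (a * b * c))⁻¹ := by
      simp only [mul_inv_rev, ia, ib, ic]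
      have : c * a * b * c * a * b = c * (a * b) * c * (a * b) := by simp only [mul_assoc]
      rw [this, hab]
      simp only [mul_assoc]
    rw [this]; exact inv_mul_cancel _
  have : (a * b * c) ^ 4 = (a * b * c) ^ 3 * (a * b * c) := pow_succ _ _
  rwa [k2, h3, one_mul, eq_comm] at this

/-- Transitivity of commuting for involutions (no elements of order 4 or 6). -/
lemma aux_all {N : Type*} [Group N] (hN : ∀ n : N, n ^ 2 = 1 ∨ n ^ 3 = 1)
    (x y : N) (hx : x ^ 2 = 1) (hy : y ^ 2 = 1) (hx1 : x ≠ 1) (hy1 : y ≠ 1)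
    (hxy : x ≠ y) (hc : x * y = y * x) : ∀ s t : N, s ^ 2 = 1 → t ^ 2 = 1 → s * t = t * s := by
  -- the centralizer of an involution has exponent two
  have cen : ∀ u g : N, u ^ 2 = 1 → u ≠ 1 → u * g = g * u → g ^ 2 = 1 := by
    intro u g hu hu1 hug
    rcases hN g with h | h
    · exact h
    · have hcomm : Commute u g := hug
      rcases hN (u * g) with h' | h'
      · rw [hcomm.mul_pow, hu, one_mul] at h'
        exact h'
      · rw [hcomm.mul_pow, h, mul_one, pow_succ, hu, one_mul] at h'
        exact absurd h' hu1
  have comm2 : ∀ p q : N, p ^ 2 = 1 → q ^ 2 = 1 → (p * q) ^ 2 = 1 → p * q = q * p := by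
    intro p q hp hq hpq
    rw [sq] at hp hq hpq
    have ip : p⁻¹ = p := inv_eq_of_mul_eq_one_right hp
    have iq : q⁻¹ = q := inv_eq_of_mul_eq_one_right hq
    have := inv_eq_of_mul_eq_one_right hpq
    rw [mul_inv_rev, ip, iq] at this
    exact this.symm
  have tr : ∀ u p q : N, u ^ 2 = 1 → u ≠ 1 → u * p = p * u → u * q = q * u → p * q = q * p := by
    intro u p q hu hu1 hp hq
    refine comm2 p q (cen u p hu hu1 hp) (cen u q hu hu1 hq) (cen u (p * q) hu hu1 ?_)
    rw [← mul_assoc, hp, mul_assoc, hq, mul_assoc]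
  have main : ∀ z : N, z ^ 2 = 1 → x * z = z * x := by
    intro z hz
    by_contra hn
    have hxy1 : x * y ≠ 1 := by
      intro h
      apply hxy
      rw [sq] at hy
      exact (mul_right_cancel (h.trans hy.symm))
    have n1 : (x * z) ^ 3 = 1 := (hN _).resolve_left fun h => hn (comm2 _ _ hx hz h)
    have n2 : (y * z) ^ 3 = 1 := (hN _).resolve_left fun h =>
      hn (tr y x z hy hy1 hc.symm (comm2 _ _ hy hz h))
    have hxy2 : (x * y) ^ 2 = 1 := by
      rw [(show Commute x y from hc).mul_pow, hx, hy, one_mul]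
    have n3 : (x * y * z) ^ 3 = 1 := (hN _).resolve_left fun h =>
      hn (tr (x * y) x z hxy2 hxy1 (by rw [mul_assoc, ← hc]) (comm2 _ _ hxy2 hz h))
    have := aux_cox x y z (by rwa [sq] at hx) (by rwa [sq] at hy) (by rwa [sq] at hz) hc n1 n2 n3
    have hz' : x * y = z := by
      rw [sq] at hz
      exact mul_right_cancel (this.trans hz.symm)
    apply hn
    rw [← hz', mul_assoc, ← hc]
  intro s t hs ht
  exact tr x s t hx hx1 (main s hs) (main t ht)

/-- If distinct involutions never commute, the elements of order 3 form a subgroup. -/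
lemma aux_three {N : Type*} [Group N] [Finite N] (hN : ∀ n : N, n ^ 2 = 1 ∨ n ^ 3 = 1)
    (a : N) (ha : a ^ 2 = 1) (ha1 : a ≠ 1)
    (hnc : ∀ s t : N, s ^ 2 = 1 → t ^ 2 = 1 → s ≠ 1 → t ≠ 1 → s * t = t * s → s = t) :
    ∀ k l : N, k ^ 3 = 1 → l ^ 3 = 1 → (k * l) ^ 3 = 1 := by
  classical
  have : Fintype N := Fintype.ofFinite N
  have comm2 : ∀ p q : N, p ^ 2 = 1 → q ^ 2 = 1 → (p * q) ^ 2 = 1 → p * q = q * p := by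
    intro p q hp hq hpq
    rw [sq] at hp hq hpq
    have ip : p⁻¹ = p := inv_eq_of_mul_eq_one_right hp
    have iq : q⁻¹ = q := inv_eq_of_mul_eq_one_right hq
    have := inv_eq_of_mul_eq_one_right hpq
    rw [mul_inv_rev, ip, iq] at this
    exact this.symm
  have cen : ∀ g : N, a * g = g * a → g = 1 ∨ g = a := by
    intro g hug
    by_cases hg : g = 1
    · exact Or.inl hg
    right
    rcases hN g with h | h
    · exact (hnc a g ha h ha1 hg hug).symm
    · have hcomm : Commute a g := hug
      rcases hN (a * g) with h' | h'
      · rw [hcomm.mul_pow, ha, one_mul] at h'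
        exact (hnc a g ha h' ha1 hg hug).symm
      · rw [hcomm.mul_pow, h, mul_one, pow_succ, ha, one_mul] at h'
        exact absurd h' ha1
  let I : Finset N := Finset.univ.filter fun z => z ^ 2 = 1 ∧ z ≠ 1
  let K : Finset N := Finset.univ.filter fun z => ¬ (z ^ 2 = 1 ∧ z ≠ 1)
  have hIK : I.card + K.card = Fintype.card N := Finset.card_filter_add_card_filter_not _
  have prodK : ∀ s t : N, s ∈ I → t ∈ I → (s * t) ^ 3 = 1 := by
    intro s t hs ht
    simp only [I, Finset.mem_filter, Finset.mem_univ, true_and] at hs ht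
    rcases hN (s * t) with h | h
    · have := hnc s t hs.1 ht.1 hs.2 ht.2 (comm2 s t hs.1 ht.1 h)
      subst this
      rw [← sq, hs.1, one_pow]
    · exact h
  have haI : a ∈ I := by simp [I, ha, ha1]
  have K3 : ∀ g : N, g ^ 3 = 1 → g ∈ K := by
    intro g hg
    simp only [K, Finset.mem_filter, Finset.mem_univ, true_and]
    rintro ⟨h, h'⟩
    rw [pow_succ, h, one_mul] at hg
    exact h' hg
  have hle : Fintype.card N ≤ 2 * I.card := by
    have := Finset.card_le_mul_card_image_of_maps_to (s := (Finset.univ : Finset N)) (t := I)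
      (f := fun g => g * a * g⁻¹) (fun g _ => by
        simp only [I, Finset.mem_filter, Finset.mem_univ, true_and]
        refine ⟨by rw [conj_pow, ha]; simp, fun h => ha1 (by simpa using h)⟩) 2 (fun z _ => by
        by_cases hne : ∃ g0, g0 * a * g0⁻¹ = z
        · obtain ⟨g0, rfl⟩ := hne
          refine (Finset.card_le_card (t := {g0, g0 * a}) ?_).trans Finset.card_le_two
          intro g hg
          simp only [Finset.mem_filter, Finset.mem_univ, true_and] at hg
          have : a * (g0⁻¹ * g) = (g0⁻¹ * g) * a := by
            have h2 : g * a = g0 * a * g0⁻¹ * g := by rw [← hg]; group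
            rw [mul_assoc g0⁻¹, h2]; group
          rcases cen _ this with h | h
          · simp [inv_mul_eq_one.mp h]
          · simp [inv_mul_eq_iff_eq_mul.mp h]
        · rw [Finset.card_eq_zero.mpr]
          · omega
          · ext g
            simp only [Finset.mem_filter, Finset.mem_univ, true_and, Finset.notMem_empty, iff_false]
            exact fun h => hne ⟨g, h⟩)
    simpa using this
  have himg : I.image (fun z => a * z) = K := by
    apply Finset.eq_of_subset_of_card_le
    · intro g hg
      obtain ⟨z, hz, rfl⟩ := Finset.mem_image.mp hg
      exact K3 _ (prodK a z haI hz)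
    · rw [Finset.card_image_of_injective _ (mul_right_injective a)]
      omega
  intro k l hk hl
  have hk' : k⁻¹ ∈ K := K3 _ (by rw [inv_pow, hk, inv_one])
  have hl' := K3 l hl
  rw [← himg] at hk' hl'
  obtain ⟨z, hz, hz2⟩ := Finset.mem_image.mp hk'
  obtain ⟨w, hw, rfl⟩ := Finset.mem_image.mp hl'
  have : k = z⁻¹ * a⁻¹ := by rw [← mul_inv_rev]; exact (inv_eq_iff_eq_inv.mp hz2.symm)
  have : k * (a * w) = z * w := by
    have iz : z⁻¹ = z := by
      apply inv_eq_of_mul_eq_one_right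
      rw [← sq]
      exact (Finset.mem_filter.mp hz).2.1
    rw [this, iz]; group
  rw [this]
  exact prodK z w hz hw

/-- Dichotomy. -/
lemma aux_dich {N : Type*} [Group N] [Finite N] (hN : ∀ n : N, n ^ 2 = 1 ∨ n ^ 3 = 1) :
    (∀ s t : N, s ^ 2 = 1 → t ^ 2 = 1 → s * t = t * s) ∨
    ((∀ k l : N, k ^ 3 = 1 → l ^ 3 = 1 → (k * l) ^ 3 = 1) ∧ ∃ k : N, k ^ 3 = 1 ∧ k ≠ 1) := by
  by_cases h : ∀ s t : N, s ^ 2 = 1 → t ^ 2 = 1 → s * t = t * s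
  · exact Or.inl h
  right
  have hnc : ∀ s t : N, s ^ 2 = 1 → t ^ 2 = 1 → s ≠ 1 → t ≠ 1 → s * t = t * s → s = t := by
    intro s t hs ht hs1 ht1 hst
    by_contra hne
    exact h (aux_all hN s t hs ht hs1 ht1 hne hst)
  push Not at h
  obtain ⟨s, t, hs, ht, hst⟩ := h
  have hs1 : s ≠ 1 := by rintro rfl; simp at hst
  refine ⟨aux_three hN s hs hs1 hnc, s * t, (hN _).resolve_left ?_, ?_⟩
  · intro hpq
    rw [sq] at hs ht hpq
    have := inv_eq_of_mul_eq_one_right hpq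
    rw [mul_inv_rev, inv_eq_of_mul_eq_one_right hs, inv_eq_of_mul_eq_one_right ht] at this
    exact hst this.symm
  · intro h1
    apply hst
    rw [h1, mul_eq_one_comm.mp h1]

lemma aux_P {G : Type*} [Group G] (hP : PropertyP G) (x y : G) (hx : orderOf x = 2) :
    (x * y = y * x ∧ (y ^ 4 = 1 ∨ y ^ 6 = 1)) ∨ y ^ 3 = 1 := by
  have tr : ∀ (H : Type) [Group H] (e : ↥(Subgroup.closure {x, y}) ≃* H)
      (_ : ∀ u v : H, u ^ 2 = 1 → (u * v = v * u ∧ (v ^ 4 = 1 ∨ v ^ 6 = 1)) ∨ v ^ 3 = 1),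
      (x * y = y * x ∧ (y ^ 4 = 1 ∨ y ^ 6 = 1)) ∨ y ^ 3 = 1 := by
    intro H _ e h
    let x' : ↥(Subgroup.closure {x, y}) := ⟨x, Subgroup.subset_closure (by simp)⟩
    let y' : ↥(Subgroup.closure {x, y}) := ⟨y, Subgroup.subset_closure (by simp)⟩
    have hx2 : x ^ 2 = 1 := hx ▸ pow_orderOf_eq_one x
    have hx' : x' ^ 2 = 1 := Subtype.ext hx2
    have := h (e x') (e y') (by rw [← map_pow, hx', map_one])
    simp only [← map_pow, ← map_mul, e.apply_eq_iff_eq, EmbeddingLike.map_eq_one_iff,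
      Subtype.ext_iff] at this
    exact this
  have ab : ∀ (H : Type) [CommGroup H] (e : ↥(Subgroup.closure {x, y}) ≃* H)
      (_ : ∀ v : H, v ^ 4 = 1 ∨ v ^ 6 = 1),
      (x * y = y * x ∧ (y ^ 4 = 1 ∨ y ^ 6 = 1)) ∨ y ^ 3 = 1 := fun H _ e h =>
    tr H e fun u v _ => Or.inl ⟨mul_comm u v, h v⟩
  rcases hP.2 x y hx with ⟨⟨e⟩⟩ | ⟨⟨e⟩⟩ | ⟨⟨e⟩⟩ | ⟨⟨e⟩⟩ | ⟨⟨e⟩⟩ | ⟨⟨e⟩⟩ | ⟨⟨e⟩⟩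
  · exact ab _ e (by decide)
  · exact ab _ e (by decide)
  · exact ab _ e (by decide)
  · exact ab _ e (by decide)
  · exact ab _ e (by decide)
  · exact ab _ e (by decide)
  · set_option maxRecDepth 100000 in exact tr _ e (by decide)

/-- if `G` has property (P), `O₃(G) = 1` and `G` has an element of
order 4, then `Ω₁(G)` is a proper subgroup of `O₂(G)`. -/
theorem stmt5 (G : Type*) [Group G] [Finite G] (hP : PropertyP G)
    (h3 : pCore 3 G = ⊥) (h4 : ∃ g : G, orderOf g = 4) :
    omegaOne G < pCore 2 G := by
  have : Fact (Nat.Prime 2) := ⟨Nat.prime_two⟩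
  have : Fact (Nat.Prime 3) := ⟨Nat.prime_three⟩
  obtain ⟨g, hg⟩ := h4
  have hg4 : g ^ 4 = 1 := hg ▸ pow_orderOf_eq_one g
  have hg2 : g ^ 2 ≠ 1 := fun h => by
    have := orderOf_dvd_of_pow_eq_one h
    rw [hg] at this
    omega
  have ord2 : ∀ x : G, x ^ 2 = 1 → x ≠ 1 → orderOf x = 2 := fun x h h' => orderOf_eq_prime h h'
  obtain ⟨V, hV⟩ : ∃ V : Subgroup G, V = omegaOne G := ⟨_, rfl⟩
  have hmemV : ∀ x : G, x ^ 2 = 1 → x ∈ V := by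
    intro x hx
    by_cases h : x = 1
    · rw [h]; exact one_mem _
    · rw [hV]; exact Subgroup.subset_closure (ord2 x hx h)
  -- elements with `y ^ 4 = 1` commute with involutions
  have comm4 : ∀ x y : G, orderOf x = 2 → y ^ 4 = 1 → x * y = y * x := by
    intro x y hx hy
    rcases aux_P hP x y hx with h | h
    · exact h.1
    · have : y = 1 := by rwa [pow_succ, h, one_mul] at hy
      simp [this]
  have sq4 : ∀ x : G, orderOf x = 2 → x ^ 2 = 1 := fun x hx => hx ▸ pow_orderOf_eq_one x
  have cenV : ∀ y : G, (∀ x : G, orderOf x = 2 → x * y = y * x) → ∀ v ∈ V, v * y = y * v := by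
    intro y hy v hv
    rw [hV] at hv
    have : omegaOne G ≤ Subgroup.centralizer {y} := by
      rw [omegaOne, Subgroup.closure_le]
      intro x hx
      rw [SetLike.mem_coe, Subgroup.mem_centralizer_singleton_iff]
      exact hy x hx
    have := this hv
    rwa [Subgroup.mem_centralizer_singleton_iff] at this
  have V2 : ∀ v ∈ V, v ^ 2 = 1 := by
    intro v hv
    rw [hV] at hv
    induction hv using Subgroup.closure_induction with
    | mem x hx => exact sq4 x hx
    | one => simp
    | mul x y hx hy ihx ihy =>
      have : Commute x y := by
        refine cenV y (fun z hz => comm4 z y hz ?_) x (hV ▸ hx)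
        rw [show 4 = 2 * 2 from rfl, pow_mul, ihy, one_pow]
      rw [this.mul_pow, ihx, ihy, one_mul]
    | inv x hx ih => rw [inv_pow, ih, inv_one]
  have Vn : V.Normal := by
    constructor
    intro n hn k
    apply hmemV
    rw [conj_pow, V2 n hn]; simp
  let C : Subgroup G := Subgroup.centralizer (V : Set G)
  have Cn : C.Normal := inferInstance
  have hC4 : ∀ y : G, y ^ 4 = 1 → y ∈ C := fun y hy => by
    rw [Subgroup.mem_centralizer_iff]
    exact cenV y fun x hx => comm4 x y hx hy
  have hVC : V ≤ C := fun v hv => hC4 v (by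
    rw [show 4 = 2 * 2 from rfl, pow_mul, V2 v hv, one_pow])
  let π : G →* G ⧸ V := QuotientGroup.mk' V
  have hπ : ∀ y : G, π y = 1 ↔ y ∈ V := fun y => QuotientGroup.eq_one_iff y
  let N : Subgroup (G ⧸ V) := C.map π
  have Nn : N.Normal := Cn.map π (QuotientGroup.mk'_surjective V)
  have x0 : ∃ x : G, orderOf x = 2 := ⟨g ^ 2, ord2 _ (by rw [← pow_mul]; exact hg4) hg2⟩
  obtain ⟨x0, hx0⟩ := x0
  have hN : ∀ n ∈ N, n ^ 2 = 1 ∨ n ^ 3 = 1 := by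
    rintro _ ⟨y, hy, rfl⟩
    rw [← map_pow, ← map_pow, hπ, hπ]
    rcases aux_P hP x0 y hx0 with ⟨_, h | h⟩ | h
    · left; apply hmemV; rw [← pow_mul]; exact h
    · right; apply hmemV; rw [← pow_mul]; exact h
    · right; rw [h]; exact one_mem _
  have dich := aux_dich (N := N) (fun n => by
    rcases hN n n.2 with h | h
    · left; exact Subtype.ext h
    · right; exact Subtype.ext h)
  have le_core : ∀ (p : ℕ) (M : Subgroup G), M.Normal → IsPGroup p M → M ≤ pCore p G :=
    fun p M h1 h2 => le_iSup (fun P : {P : Subgroup G // P.Normal ∧ IsPGroup p ↥P} =>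
      (P : Subgroup G)) ⟨M, h1, h2⟩
  rcases dich with hcomm | ⟨hmul, k, hk, hk1⟩
  · -- involutions of N commute
    have hcomm' : ∀ s t : G ⧸ V, s ∈ N → t ∈ N → s ^ 2 = 1 → t ^ 2 = 1 → s * t = t * s := by
      intro s t hs ht h1 h2
      exact congrArg Subtype.val (hcomm ⟨s, hs⟩ ⟨t, ht⟩ (Subtype.ext h1) (Subtype.ext h2))
    let T : Subgroup (G ⧸ V) :=
      { carrier := {n | n ∈ N ∧ n ^ 2 = 1}
        one_mem' := ⟨one_mem _, one_pow _⟩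
        mul_mem' := by
          rintro s t ⟨hs, hs2⟩ ⟨ht, ht2⟩
          refine ⟨mul_mem hs ht, ?_⟩
          rw [(show Commute s t from hcomm' s t hs ht hs2 ht2).mul_pow, hs2, ht2, one_mul]
        inv_mem' := by
          rintro s ⟨hs, hs2⟩
          exact ⟨inv_mem hs, by rw [inv_pow, hs2, inv_one]⟩ }
    have Tn : T.Normal := by
      constructor
      rintro n ⟨hn, hn2⟩ q
      exact ⟨Nn.conj_mem n hn q, by rw [conj_pow, hn2]; simp⟩
    let M := T.comap π
    have hM : M ≤ pCore 2 G := by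
      apply le_core 2 M (Tn.comap π)
      rintro ⟨m, hm⟩
      refine ⟨2, Subtype.ext ?_⟩
      have : π m ^ 2 = 1 := hm.2
      rw [← map_pow, hπ] at this
      have := V2 _ this
      rw [← pow_mul] at this
      exact this
    have hgM : g ∈ M := by
      refine ⟨⟨g, hC4 g hg4, rfl⟩, ?_⟩
      rw [← map_pow, hπ]
      apply hmemV
      rw [← pow_mul]; exact hg4
    rw [← hV]
    refine lt_of_le_of_ne (fun v hv => hM ?_) ?_
    · have : π v = 1 := (hπ v).mpr hv
      show π v ∈ T
      rw [this]; exact one_mem _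
    · intro h
      exact hg2 (V2 g (h ▸ hM hgM))
  · exfalso
    let T : Subgroup (G ⧸ V) :=
      { carrier := {n | n ∈ N ∧ n ^ 3 = 1}
        one_mem' := ⟨one_mem _, one_pow _⟩
        mul_mem' := by
          rintro s t ⟨hs, hs2⟩ ⟨ht, ht2⟩
          refine ⟨mul_mem hs ht, ?_⟩
          exact congrArg Subtype.val (hmul ⟨s, hs⟩ ⟨t, ht⟩ (Subtype.ext hs2) (Subtype.ext ht2))
        inv_mem' := by
          rintro s ⟨hs, hs2⟩
          exact ⟨inv_mem hs, by rw [inv_pow, hs2, inv_one]⟩ }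
    have Tn : T.Normal := by
      constructor
      rintro n ⟨hn, hn2⟩ q
      exact ⟨Nn.conj_mem n hn q, by rw [conj_pow, hn2]; simp⟩
    have Tp : IsPGroup 3 T := by
      rintro ⟨t, ht⟩
      exact ⟨1, Subtype.ext (by simpa using ht.2)⟩
    let M := T.comap π
    have Mn : M.Normal := Tn.comap π
    have hMC : ∀ m ∈ M, m ∈ C := by
      intro m hm
      obtain ⟨c, hc, hcm⟩ := hm.1
      have : c⁻¹ * m ∈ V := QuotientGroup.eq.mp hcm
      have := mul_mem hc (hVC this)
      simpa using this
    let φ : M →* T := π.subgroupComap T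
    have hker : φ.ker ≤ Subgroup.center M := by
      intro m hm
      rw [Subgroup.mem_center_iff]
      intro n
      have hmV : (m : G) ∈ V := (hπ _).mp (congrArg Subtype.val hm)
      have := hMC n n.2
      rw [Subgroup.mem_centralizer_iff] at this
      exact Subtype.ext (this m hmV).symm
    have Tnil : Group.IsNilpotent T := Tp.isNilpotent
    have Mnil : Group.IsNilpotent M := Subgroup.isNilpotent_of_ker_le_center φ hker
    obtain ⟨P⟩ : Nonempty (Sylow 3 M) := inferInstance
    have Pn : (P : Subgroup M).Normal :=
      ((Group.isNilpotent_of_finite_tfae (G := M)).out 0 3 rfl rfl).mp Mnil 3 inferInstance P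
    have Pc : (P : Subgroup M).Characteristic := P.characteristic_of_normal Pn
    have hn : ((P : Subgroup M).map M.subtype).Normal := inferInstance
    have hle := le_core 3 _ hn (P.2.map _)
    rw [h3, le_bot_iff, Subgroup.map_eq_bot_iff_of_injective _ M.subtype_injective] at hle
    -- yet M has an element of order divisible by 3
    obtain ⟨m, hmC, hm⟩ := k.2
    have hmM : m ∈ M := ⟨⟨m, hmC, rfl⟩, by rw [hm]; exact congrArg Subtype.val hk⟩
    have h3card : 3 ∣ Nat.card M := by
      have e1 : orderOf (π m) = 3 := by
        rw [hm]
        exact orderOf_eq_prime (congrArg Subtype.val hk) (fun h => hk1 (Subtype.ext h))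
      have e2 : orderOf (π m) ∣ orderOf m := orderOf_map_dvd π m
      rw [e1] at e2
      have e3 : orderOf m = orderOf (⟨m, hmM⟩ : M) := (Subgroup.orderOf_mk m hmM).symm
      rw [e3] at e2
      exact e2.trans (orderOf_dvd_natCard _)
    have := P.dvd_card_of_dvd_card h3card
    rw [hle] at this
    simp at this
end

section
/- Let G be a finite group with a normal nontrivial 2-subgroup K and an element z ∈ G of order 3 such that G = ⟨K, z⟩, K ∩ ⟨z⟩ = 1, every element of K has order dividing 4, Ω₁(K) ≤ Z(K), and C_K(z) = 1 (so that G = K ⋊ ⟨z⟩ is a Frobenius group with kernel K and complement ⟨z⟩ ≅ ℤ/3). Then G has property (P). -/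
section helpers

variable {G : Type*} [Group G]

theorem aux_cyc (y : G) : Nonempty (↥(Subgroup.zpowers y) ≃* Multiplicative (ZMod (orderOf y))) := by
  have := zmodCyclicMulEquiv (G := Subgroup.zpowers y) inferInstance
  rw [Nat.card_zpowers] at this
  exact ⟨this.symm⟩

theorem aux_closure_pair (x y : G) :
    Subgroup.closure {x, y} = Subgroup.zpowers x ⊔ Subgroup.zpowers y := by
  rw [Set.insert_eq, Subgroup.closure_union, ← Subgroup.zpowers_eq_closure,
    ← Subgroup.zpowers_eq_closure]

theorem aux_prod (x y : G) (h : Commute x y)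
    (hd : Disjoint (Subgroup.zpowers x) (Subgroup.zpowers y)) :
    Nonempty (↥(Subgroup.closure {x, y}) ≃*
      Multiplicative (ZMod (orderOf x)) × Multiplicative (ZMod (orderOf y))) := by
  obtain ⟨e1⟩ := aux_cyc x
  obtain ⟨e2⟩ := aux_cyc y
  have hc : ∀ (m : Subgroup.zpowers x) (n : Subgroup.zpowers y),
      Commute ((Subgroup.zpowers x).subtype m) ((Subgroup.zpowers y).subtype n) := by
    rintro ⟨_, a, rfl⟩ ⟨_, b, rfl⟩
    exact (h.zpow_zpow a b)
  let f := MonoidHom.noncommCoprod _ _ hc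
  have hf : Function.Injective f := by
    rw [MonoidHom.noncommCoprod_injective]
    refine ⟨Subtype.val_injective, Subtype.val_injective, ?_⟩
    simpa using hd
  have hr : f.range = Subgroup.closure {x, y} := by
    rw [MonoidHom.noncommCoprod_range, aux_closure_pair]
    simp
  exact ⟨((MulEquiv.subgroupCongr hr).symm.trans (MonoidHom.ofInjective hf).symm).trans
    (e1.prodCongr e2)⟩

structure Rel4 (a b y : G) : Prop where
  ha : a * a = 1
  hb : b * b = 1
  hab : b * a = a * b
  hy : y * y * y = 1
  hya : y * a = b * y
  hyb : y * b = a * b * y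

def ee (a b y : G) (p : Fin 2 × Fin 2 × Fin 3) : G :=
  a ^ p.1.val * b ^ p.2.1.val * y ^ p.2.2.val

def sx (p : Fin 2 × Fin 2 × Fin 3) : Fin 2 × Fin 2 × Fin 3 :=
  if p.2.2 = 0 then (p.1 + 1, p.2.1, p.2.2) else
  if p.2.2 = 1 then (p.1, p.2.1 + 1, p.2.2) else (p.1 + 1, p.2.1 + 1, p.2.2)

def sy (p : Fin 2 × Fin 2 × Fin 3) : Fin 2 × Fin 2 × Fin 3 := (p.1, p.2.1, p.2.2 + 1)

theorem ee_sy {a b y : G} (h : Rel4 a b y) (p) : ee a b y (sy p) = ee a b y p * y := by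
  obtain ⟨i, j, k⟩ := p
  have := h.hy
  fin_cases k <;> simp [ee, sy, mul_assoc, pow_succ] 
  rw [← mul_assoc y, this]

theorem ee_sx {a b y : G} (h : Rel4 a b y) (p) : ee a b y (sx p) = ee a b y p * a := by
  obtain ⟨i, j, k⟩ := p
  obtain ⟨ha, hb, hab, hy, hya, hyb⟩ := h
  have ha' : ∀ t, a * (a * t) = t := fun t => by rw [← mul_assoc, ha, one_mul]
  have hb' : ∀ t, b * (b * t) = t := fun t => by rw [← mul_assoc, hb, one_mul]
  have hab' : ∀ t, b * (a * t) = a * (b * t) := fun t => by rw [← mul_assoc, hab, mul_assoc]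
  have hyb' : ∀ t, y * (b * t) = a * (b * (y * t)) := fun t => by
    rw [← mul_assoc, hyb]; simp only [mul_assoc]
  fin_cases i <;> fin_cases j <;> fin_cases k <;>
    simp [ee, sx, mul_assoc, pow_succ, ha, hb, hab, hya, hyb, ha', hb', hab', hyb']

theorem rel_comm {a b y : G} (h : Rel4 a b y) (hc : y * a = a * y) : a = 1 := by
  have h1 : a = b := mul_right_cancel (hc.symm.trans h.hya)
  have h2 := h.hyb
  rw [← h1, h.ha, one_mul] at h2
  simpa using h2

theorem ee_one {a b y : G} (h : Rel4 a b y) (hne : a ≠ 1) (p) (hp : ee a b y p = 1) : p = 0 := by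
  obtain ⟨i, j, k⟩ := p
  have hc : Commute a b := h.hab.symm
  have hky : Commute (y ^ k.val) a := by
    have : y ^ k.val = (a ^ i.val * b ^ j.val)⁻¹ := by
      simpa [ee] using (inv_eq_of_mul_eq_one_right hp).symm
    rw [this]
    exact (((Commute.refl a).pow_left _).mul_left (hc.symm.pow_left _)).inv_left
  have hk : k = 0 := by
    by_contra hk
    apply hne
    apply rel_comm h
    have : Commute y a := by
      fin_cases k
      · simp at hk
      · simpa using hky
      · have h2 : y = (y ^ 2) ^ 2 := by
          have h3 : y ^ 3 = 1 := by rw [pow_succ, pow_two]; exact h.hy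
          rw [← pow_mul, show 2 * 2 = 3 + 1 from rfl, pow_succ, h3, one_mul]
        rw [h2]
        exact Commute.pow_left (by simpa using hky) 2
    exact this
  subst hk
  have hb1 : b ≠ 1 := by
    intro hb
    have := h.hya
    rw [hb, one_mul] at this
    exact hne (by simpa using this)
  have hab1 : a * b ≠ 1 := by
    intro hb
    have := h.hyb
    rw [hb, one_mul] at this
    exact hb1 (by simpa using this)
  fin_cases i <;> fin_cases j <;> simp_all [ee]

def p4a : Equiv.Perm (Fin 4) := Equiv.swap 0 1 * Equiv.swap 2 3
def p4y : Equiv.Perm (Fin 4) := Equiv.swap 0 1 * Equiv.swap 1 2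

def a4a : alternatingGroup (Fin 4) := ⟨p4a, by rw [Equiv.Perm.mem_alternatingGroup]; decide⟩
def a4y : alternatingGroup (Fin 4) := ⟨p4y, by rw [Equiv.Perm.mem_alternatingGroup]; decide⟩
def a4b : alternatingGroup (Fin 4) := a4y * a4a * a4y * a4y

theorem rel_a4 : Rel4 a4a a4b a4y := by
  constructor <;> decide

theorem ee_bij : Function.Bijective (ee a4a a4b a4y) := by
  have hi : Function.Injective (ee a4a a4b a4y) := by
    decide
  rw [Fintype.bijective_iff_injective_and_card]
  refine ⟨hi, ?_⟩
  rw [← Nat.card_eq_fintype_card (α := alternatingGroup (Fin 4)), nat_card_alternatingGroup]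
  simp [Nat.factorial]

theorem aux_a4 {a b y : G} (h : Rel4 a b y) (hne : a ≠ 1) :
    Nonempty (↥(Subgroup.closure {a, y}) ≃* alternatingGroup (Fin 4)) := by
  let E := Equiv.ofBijective _ ee_bij
  have hE : ∀ p, E p = ee a4a a4b a4y p := fun p => rfl
  let φ : alternatingGroup (Fin 4) → G := fun s => ee a b y (E.symm s)
  have hφ : ∀ p, φ (ee a4a a4b a4y p) = ee a b y p := fun p => by
    simp [φ, ← hE]
  have hφ1 : φ 1 = 1 := by
    have : (1 : alternatingGroup (Fin 4)) = ee a4a a4b a4y (0, 0, 0) := by simp [ee]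
    rw [this, hφ]; simp [ee]
  have sa : ∀ s, φ (s * a4a) = φ s * a := fun s => by
    obtain ⟨p, rfl⟩ := ee_bij.2 s
    rw [← ee_sx rel_a4, hφ, hφ, ee_sx h]
  have sy' : ∀ s, φ (s * a4y) = φ s * y := fun s => by
    obtain ⟨p, rfl⟩ := ee_bij.2 s
    rw [← ee_sy rel_a4, hφ, hφ, ee_sy h]
  have φa : φ a4a = a := by simpa [hφ1] using sa 1
  have φy : φ a4y = y := by simpa [hφ1] using sy' 1
  let Q : Submonoid (alternatingGroup (Fin 4)) :=
    { carrier := {q | ∀ s, φ (s * q) = φ s * φ q}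
      one_mem' := fun s => by simp [hφ1]
      mul_mem' := fun {q r} hq hr s => by
        rw [← mul_assoc, hr, hq, hr, mul_assoc] }
  have Qa : a4a ∈ Q := fun s => by rw [sa, φa]
  have Qy : a4y ∈ Q := fun s => by rw [sy', φy]
  have Qb : a4b ∈ Q := Q.mul_mem (Q.mul_mem (Q.mul_mem Qy Qa) Qy) Qy
  have Qall : ∀ q, q ∈ Q := fun q => by
    obtain ⟨p, rfl⟩ := ee_bij.2 q
    exact Q.mul_mem (Q.mul_mem (Q.pow_mem Qa _) (Q.pow_mem Qb _)) (Q.pow_mem Qy _)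
  let f : alternatingGroup (Fin 4) →* G :=
    { toFun := φ
      map_one' := hφ1
      map_mul' := fun s q => Qall q s }
  have hf : Function.Injective f := by
    rw [injective_iff_map_eq_one]
    intro s hs
    obtain ⟨p, rfl⟩ := ee_bij.2 s
    have h1 : ee a b y p = 1 := (hφ p).symm.trans hs
    rw [ee_one h hne p h1]
    simp [ee]
  have hr : f.range = Subgroup.closure {a, y} := by
    have ha : a ∈ Subgroup.closure {a, y} := Subgroup.subset_closure (by simp)
    have hy : y ∈ Subgroup.closure {a, y} := Subgroup.subset_closure (by simp)
    have hb : b ∈ Subgroup.closure {a, y} := by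
      have : b = y * a * y⁻¹ := by rw [h.hya]; simp
      rw [this]
      exact mul_mem (mul_mem hy ha) (inv_mem hy)
    apply le_antisymm
    · rintro _ ⟨s, rfl⟩
      obtain ⟨p, rfl⟩ := ee_bij.2 s
      change φ _ ∈ _
      rw [hφ]
      exact mul_mem (mul_mem (pow_mem ha _) (pow_mem hb _)) (pow_mem hy _)
    · rw [Subgroup.closure_le]
      rintro t (rfl | rfl)
      · exact ⟨a4a, φa⟩
      · exact ⟨a4y, φy⟩
  exact ⟨(MulEquiv.subgroupCongr hr).symm.trans (MonoidHom.ofInjective hf).symm⟩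

theorem aux_conj [Finite G] (K : Subgroup G) (hK : K.Normal) (w : G)
    (hf : ∀ k ∈ K, k * w = w * k → k = 1) (k : G) (hk : k ∈ K) :
    ∃ g ∈ K, k * w = g * w * g⁻¹ := by
  let f : K → K := fun g => ⟨g * (w * (g : G)⁻¹ * w⁻¹), 
    mul_mem g.2 (hK.conj_mem _ (inv_mem g.2) w)⟩
  have hi : Function.Injective f := by
    rintro ⟨g, hg⟩ ⟨h, hh⟩ e
    have e' : g * (w * g⁻¹ * w⁻¹) = h * (w * h⁻¹ * w⁻¹) := congrArg Subtype.val e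
    have e2 : g * w * g⁻¹ = h * w * h⁻¹ := by
      simpa [← mul_assoc] using e'
    have := hf (h⁻¹ * g) (mul_mem (inv_mem hh) hg) (by
      rw [mul_inv_eq_iff_eq_mul] at e2
      rw [mul_assoc, e2]; group)
    rw [inv_mul_eq_one] at this
    exact Subtype.ext this.symm
  obtain ⟨⟨g, hg⟩, e⟩ := Finite.surjective_of_injective hi ⟨k, hk⟩
  refine ⟨g, hg, ?_⟩
  have e' : g * (w * g⁻¹ * w⁻¹) = k := congrArg Subtype.val e
  rw [← e']; group

theorem aux_out [Finite G] (K : Subgroup G) (hK : K.Normal) (w : G) (hw : w ^ 3 = 1)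
    (hf : ∀ k ∈ K, k * w = w * k → k = 1) (k : G) (hk : k ∈ K) :
    (k * w) ^ 3 = 1 ∧ ∀ c ∈ K, c * (k * w) = (k * w) * c → c = 1 := by
  obtain ⟨g, hg, e⟩ := aux_conj K hK w hf k hk
  rw [e]
  refine ⟨by rw [conj_pow, hw]; simp, fun c hc h => ?_⟩
  have := hf (g⁻¹ * c * g) (mul_mem (mul_mem (inv_mem hg) hc) hg) (by
    have h2 : g⁻¹ * (c * (g * w * g⁻¹)) * g = g⁻¹ * ((g * w * g⁻¹) * c) * g := by rw [h]
    calc _ = g⁻¹ * (c * (g * w * g⁻¹)) * g := by group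
      _ = _ := by rw [h2]; group)
  have h3 : c = g * (g⁻¹ * c * g) * g⁻¹ := by group
  rw [h3, this]; simp

end helpers

/-- sufficiency for family (c): if `G = K ⋊ ⟨z⟩` is a Frobenius group
with kernel a nontrivial normal 2-subgroup `K` of exponent dividing 4 with
`Ω₁(K) ≤ Z(K)` and complement `⟨z⟩ ≅ ℤ/3` acting without nontrivial fixed points,
then `G` has property (P). -/
theorem stmt15 (G : Type*) [Group G] [Finite G] (K : Subgroup G) (z : G)
    (hKnormal : K.Normal) (hKnt : K ≠ ⊥) (hK2 : IsPGroup 2 ↥K)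
    (hz : orderOf z = 3)
    (hgen : K ⊔ Subgroup.zpowers z = ⊤)
    (hint : K ⊓ Subgroup.zpowers z = ⊥)
    (hexp : ∀ k ∈ K, orderOf k ∣ 4)
    (hOm : omegaOne ↥K ≤ Subgroup.center ↥K)
    (hfpf : ∀ k ∈ K, k * z = z * k → k = 1) :
    PropertyP G := by
  have hz3 : z ^ 3 = 1 := hz ▸ pow_orderOf_eq_one z
  have hzi3 : (z⁻¹) ^ 3 = 1 := by rw [inv_pow, hz3, inv_one]
  have hfi : ∀ k ∈ K, k * z⁻¹ = z⁻¹ * k → k = 1 := fun k hk h =>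
    hfpf k hk (by
      have : Commute k z⁻¹ := h
      simpa using this.inv_right.eq)
  have hdich : ∀ g : G, g ∈ K ∨ (g ^ 3 = 1 ∧ ∀ c ∈ K, c * g = g * c → c = 1) := by
    intro g
    have hg : g ∈ K ⊔ Subgroup.zpowers z := hgen ▸ Subgroup.mem_top g
    rw [Subgroup.mem_sup_of_normal_left] at hg
    obtain ⟨k, hk, _, ⟨n, rfl⟩, rfl⟩ := hg
    have hmod : z ^ n = z ^ (n % 3) := by
      have := zpow_mod_orderOf z n
      rw [hz] at this
      exact this.symm
    have h3 : n % 3 = 0 ∨ n % 3 = 1 ∨ n % 3 = 2 := by omega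
    simp only [hmod]
    rcases h3 with h | h | h <;> rw [h]
    · left; simpa using hk
    · right
      rw [zpow_one]
      exact aux_out K hKnormal z hz3 hfpf k hk
    · right
      have : z ^ (2 : ℤ) = z⁻¹ := by
        rw [eq_inv_iff_mul_eq_one, ← hz3]
        have := pow_succ z 2
        rw [this]
        norm_cast
      rw [this]
      exact aux_out K hKnormal z⁻¹ hzi3 hfi k hk
  refine ⟨?_, ?_⟩
  · obtain ⟨k, hk, hk1⟩ := (Subgroup.ne_bot_iff_exists_ne_one (H := K)).1 hKnt |>.elim
      fun a ha => (⟨a.1, a.2, fun h => ha (Subtype.ext h)⟩ : ∃ k, k ∈ K ∧ k ≠ 1)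
    have h4 := hexp k hk
    have h1 : orderOf k ≠ 1 := fun h => hk1 (orderOf_eq_one_iff.1 h)
    have h2 : 2 ∣ orderOf k := by
      have : orderOf k ≤ 4 := Nat.le_of_dvd (by norm_num) h4
      interval_cases orderOf k <;> omega
    exact even_iff_two_dvd.2 (h2.trans (orderOf_dvd_natCard k))
  intro x y hx
  have hx1 : x ≠ 1 := fun h => by simp [h] at hx
  have hxx : x ^ 2 = 1 := hx ▸ pow_orderOf_eq_one x
  have inK : ∀ x : G, x ^ 2 = 1 → x ∈ K := by
    intro x hxx
    rcases hdich x with h | ⟨h, -⟩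
    · exact h
    · have : x = 1 := by rw [pow_succ, hxx, one_mul] at h; exact h
      rw [this]; exact one_mem K
  have hcen : ∀ x : G, orderOf x = 2 → ∀ k ∈ K, Commute x k := by
    intro x hx k hk
    have hxK : x ∈ K := inK x (hx ▸ pow_orderOf_eq_one x)
    have h1 : (⟨x, hxK⟩ : K) ∈ omegaOne K := Subgroup.subset_closure (by
      simpa using hx)
    have h2 := Subgroup.mem_center_iff.1 (hOm h1) ⟨k, hk⟩
    exact (congrArg Subtype.val h2).symm
  have hxK := inK x hxx
  rcases hdich y with hy | ⟨hy3, hyf⟩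
  · have hc := hcen x hx y hy
    have h4 := hexp y hy
    have hle : orderOf y ≤ 4 := Nat.le_of_dvd (by norm_num) h4
    have hy124 : orderOf y = 1 ∨ orderOf y = 2 ∨ orderOf y = 4 := by
      interval_cases orderOf y <;> omega
    have hcl := aux_closure_pair x y
    by_cases hm : x ∈ Subgroup.zpowers y
    · rw [sup_eq_right.2 (Subgroup.zpowers_le.2 hm)] at hcl
      rw [hcl]
      have hi := aux_cyc y
      rcases hy124 with h | h | h
      · rw [orderOf_eq_one_iff.1 h] at hm
        simp at hm
        exact absurd hm hx1
      · rw [h] at hi; exact Or.inl hi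
      · rw [h] at hi; exact Or.inr (Or.inr (Or.inl hi))
    · have hd : Disjoint (Subgroup.zpowers x) (Subgroup.zpowers y) := by
        rw [Subgroup.disjoint_def]
        rintro _ ⟨n, rfl⟩ h
        simp only at h ⊢
        have hmod := zpow_mod_orderOf x n
        rw [hx] at hmod
        rw [← hmod] at h ⊢
        have h2 : n % ((2 : ℕ) : ℤ) = 0 ∨ n % ((2 : ℕ) : ℤ) = 1 := by omega
        rcases h2 with e | e <;> rw [e] at h ⊢
        · simp
        · exact absurd (by simpa using h) hm
      have hi := aux_prod x y hc hd
      rw [hx] at hi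
      rcases hy124 with h | h | h
      · have hi := aux_cyc x
        rw [orderOf_eq_one_iff.1 h, Subgroup.zpowers_one_eq_bot, sup_bot_eq] at hcl
        rw [orderOf_eq_one_iff.1 h, hcl]
        rw [hx] at hi
        exact Or.inl hi
      · rw [h] at hi; exact Or.inr (Or.inl hi)
      · rw [h] at hi; exact Or.inr (Or.inr (Or.inr (Or.inr (Or.inl hi))))
  · refine Or.inr (Or.inr (Or.inr (Or.inr (Or.inr (Or.inr ?_)))))
    obtain ⟨b, hb⟩ : ∃ b, b = y * x * y⁻¹ := ⟨_, rfl⟩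
    obtain ⟨c, hcc⟩ : ∃ c, c = y * b * y⁻¹ := ⟨_, rfl⟩
    have hbK : b ∈ K := hb ▸ hKnormal.conj_mem _ hxK y
    have hcK : c ∈ K := hcc ▸ hKnormal.conj_mem _ hbK y
    have ho : ∀ t : G, orderOf (y * t * y⁻¹) = orderOf t := fun t => by
      simpa using (MulAut.conj y).orderOf_eq t
    have hb2 : orderOf b = 2 := by rw [hb, ho, hx]
    have hbb : b ^ 2 = 1 := hb2 ▸ pow_orderOf_eq_one b
    have hxb : x * b = b * x := hcen x hx b hbK
    have hxc : x * c = c * x := hcen x hx c hcK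
    have hyc : y * c * y⁻¹ = x := by
      have : y * c * y⁻¹ = y ^ 3 * x * (y ^ 3)⁻¹ := by rw [hcc, hb]; simp only [pow_succ, pow_zero, one_mul, mul_inv_rev, mul_assoc]
      rw [this, hy3]; simp
    have hprod : x * b * c = 1 := by
      apply hyf _ (mul_mem (mul_mem hxK hbK) hcK)
      have : y * (x * b * c) * y⁻¹ = x * b * c := by
        calc y * (x * b * c) * y⁻¹ = (y * x * y⁻¹) * (y * b * y⁻¹) * (y * c * y⁻¹) := by group
          _ = b * c * x := by rw [← hb, ← hcc, hyc]
          _ = x * b * c := by rw [mul_assoc, ← hxc, ← mul_assoc, hxb]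
      rw [mul_inv_eq_iff_eq_mul] at this
      exact this.symm
    have hcx : c = x * b := by
      have h1 : (x * b) * (x * b) = 1 := by
        calc (x * b) * (x * b) = x * (b * x) * b := by group
          _ = x ^ 2 * b ^ 2 := by rw [← hxb]; simp only [pow_two, mul_assoc]
          _ = 1 := by rw [hxx, hbb, one_mul]
      exact mul_left_cancel (hprod.trans h1.symm)
    refine aux_a4 (b := b) ⟨?_, ?_, hxb.symm, ?_, ?_, ?_⟩ hx1
    · rw [← pow_two, hxx]
    · rw [← pow_two, hbb]
    · rw [← hy3, pow_succ, pow_two]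
    · rw [hb]; group
    · rw [← hcx, hcc]; group
end
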